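/- There is no monic real polynomial P of degree 5 with all coefficients nonzero whose coefficient signs form the sign pattern (+,+,−,+,−,−) and such that P has exactly 3 positive and 0 negative real roots, P′ has exactly 3 positive and 1 negative real roots, P″ has exactly 2 positive and 1 negative real roots, P‴ has exactly 1 positive and 1 negative real root, and P⁗ has exactly 0 positive and 1 negative real root, all of these roots being simple. In other words, the couple (σ, SAP) with σ = (+,+,−,+,−,−) and SAP = ((3,0), (3,1), (2,1), (1,1), (0,1)) is not realizable. -/

import Mathlib

open Polynomial

/-- Number of sign changes among consecutive entries `s 0, …, s n`. -/
def signChanges (s : ℕ → ℤ) (n : ℕ) : ℕ :=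
  ((Finset.range n).filter (fun i => s i * s (i + 1) < 0)).card

/-- Number of sign preservations among consecutive entries `s 0, …, s n`. -/
def signPres (s : ℕ → ℤ) (n : ℕ) : ℕ :=
  ((Finset.range n).filter (fun i => 0 < s i * s (i + 1))).card

/-- `s` encodes a sign pattern of length `d+1` (entries `s 0, …, s d`, each `±1`,
first entry `+1`). -/
def IsSignPattern (d : ℕ) (s : ℕ → ℤ) : Prop :=
  s 0 = 1 ∧ ∀ i ≤ d, s i = 1 ∨ s i = -1

/-- `pn k = (pos_k, neg_k)`, `k = 0, …, d-1`, is a sequence of admissible pairs (SAP)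
for the sign pattern `s` of length `d+1`: each pair is admissible for the truncated
pattern `σ_k` (of length `d+1-k`, with sign changes `signChanges s (d-k)` and sign
preservations `signPres s (d-k)`), the last entry of `σ_k` is `(-1)^{pos_k}`, and the
Rolle-type inequalities and parity condition hold between consecutive pairs. -/
def IsSAP (d : ℕ) (s : ℕ → ℤ) (pn : ℕ → ℕ × ℕ) : Prop :=
  (∀ k < d,
    (pn k).1 ≤ signChanges s (d - k) ∧
    Even ((signChanges s (d - k) : ℤ) - (pn k).1) ∧
    (pn k).2 ≤ signPres s (d - k) ∧
    Even ((signPres s (d - k) : ℤ) - (pn k).2) ∧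
    s (d - k) = (-1) ^ (pn k).1) ∧
  (∀ k, k + 1 < d →
    (pn k).1 ≤ (pn (k + 1)).1 + 1 ∧
    (pn k).2 ≤ (pn (k + 1)).2 + 1 ∧
    (pn k).1 + (pn k).2 ≤ (pn (k + 1)).1 + (pn (k + 1)).2 + 1 ∧
    Even (((pn (k + 1)).1 : ℤ) + (pn (k + 1)).2 + 3 - (pn k).1 - (pn k).2))

/-- The `k`-th derivative of a real polynomial. -/
noncomputable def iterDeriv : ℕ → Polynomial ℝ → Polynomial ℝ
  | 0, P => P
  | k + 1, P => Polynomial.derivative (iterDeriv k P)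

/-- `P` has exactly `pos` positive real roots and exactly `neg` negative real roots,
all of them simple. -/
def CountRoots (P : Polynomial ℝ) (pos neg : ℕ) : Prop :=
  {x : ℝ | 0 < x ∧ P.eval x = 0}.ncard = pos ∧
  {x : ℝ | x < 0 ∧ P.eval x = 0}.ncard = neg ∧
  ∀ x : ℝ, P.eval x = 0 → (Polynomial.derivative P).eval x ≠ 0

/-- The couple (sign pattern `s`, SAP `pn`) of degree `d` is realizable: there is a
monic real polynomial of degree `d`, with all coefficients nonzero, whose coefficient
signs define the pattern `s` (the sign of the coefficient of `x^(d-i)` is `s i`), and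
such that for `k = 0, …, d-1` the `k`-th derivative has exactly `(pn k).1` positive and
`(pn k).2` negative real roots, all simple. -/
def Realizable (d : ℕ) (s : ℕ → ℤ) (pn : ℕ → ℕ × ℕ) : Prop :=
  ∃ P : Polynomial ℝ, P.Monic ∧ P.natDegree = d ∧
    (∀ j ≤ d, P.coeff j ≠ 0) ∧
    (∀ i ≤ d, 0 < (s i : ℝ) * P.coeff (d - i)) ∧
    ∀ k < d, CountRoots (iterDeriv k P) (pn k).1 (pn k).2

lemma cubic_zero {A B C D p q r s : ℝ} (hpq : p < q) (hqr : q < r) (hrs : r < s)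
    (h1 : A*p^3+B*p^2+C*p+D = 0) (h2 : A*q^3+B*q^2+C*q+D = 0)
    (h3 : A*r^3+B*r^2+C*r+D = 0) (h4 : A*s^3+B*s^2+C*s+D = 0) :
    A = 0 ∧ B = 0 ∧ C = 0 ∧ D = 0 := by
  have e1 : A*(p^2+p*q+q^2)+B*(p+q)+C = 0 := by
    have : (q-p) ≠ 0 := by linarith
    apply mul_left_cancel₀ this; linear_combination h2 - h1
  have e2 : A*(r^2+r*q+q^2)+B*(r+q)+C = 0 := by
    have : (r-q) ≠ 0 := by linarith
    apply mul_left_cancel₀ this; linear_combination h3 - h2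
  have e3 : A*(r^2+r*s+s^2)+B*(r+s)+C = 0 := by
    have : (s-r) ≠ 0 := by linarith
    apply mul_left_cancel₀ this; linear_combination h4 - h3
  have g1 : A*(p+q+r)+B = 0 := by
    have : (r-p) ≠ 0 := by linarith
    apply mul_left_cancel₀ this; linear_combination e2 - e1
  have g2 : A*(s+q+r)+B = 0 := by
    have : (s-q) ≠ 0 := by linarith
    apply mul_left_cancel₀ this; linear_combination e3 - e2
  have hA : A = 0 := by
    have : (s-p) ≠ 0 := by linarith
    apply mul_left_cancel₀ this; linear_combination g2 - g1
  have hB : B = 0 := by subst hA; linarith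
  have hC : C = 0 := by subst hA hB; linarith
  subst hA hB hC
  exact ⟨rfl, rfl, rfl, by linarith⟩

lemma sorted3 {S : Set ℝ} (h : S.ncard = 3) :
    ∃ x y z, x < y ∧ y < z ∧ x ∈ S ∧ y ∈ S ∧ z ∈ S := by
  obtain ⟨x, y, z, hxy, hxz, hyz, rfl⟩ := Set.ncard_eq_three.1 h
  rcases lt_or_gt_of_ne hxy with h1 | h1 <;> rcases lt_or_gt_of_ne hxz with h2 | h2 <;>
    rcases lt_or_gt_of_ne hyz with h3 | h3
  · exact ⟨x, y, z, h1, h3, by simp⟩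
  · exact ⟨x, z, y, h2, h3, by simp⟩
  · linarith
  · exact ⟨z, x, y, h2, h1, by simp⟩
  · exact ⟨y, x, z, h1, h2, by simp⟩
  · linarith
  · exact ⟨y, z, x, h3, h2, by simp⟩
  · exact ⟨z, y, x, h3, h1, by simp⟩

theorem stmt19 :
    ¬ Realizable 5
        (fun i => if i = 2 then -1 else if i = 4 then -1 else if i = 5 then -1 else 1)
        (fun k => if k = 0 then (3, 0) else if k = 1 then (3, 1)
          else if k = 2 then (2, 1) else if k = 3 then (1, 1) else (0, 1)) := by
  rintro ⟨P, hm, hdeg, -, hs, hr⟩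
  have ha := hs 1 (by norm_num)
  have hd := hs 4 (by norm_num)
  have he := hs 5 (by norm_num)
  obtain ⟨hp0, hn0, -⟩ := hr 0 (by norm_num)
  obtain ⟨-, hn1, -⟩ := hr 1 (by norm_num)
  simp [iterDeriv] at ha hd he hp0 hn0 hn1
  have hP0 : P ≠ 0 := hm.ne_zero
  have h5 : P.coeff 5 = 1 := by rw [← hdeg]; exact hm
  have hPe : ∀ x, P.eval x = P.coeff 0 + P.coeff 1 * x + P.coeff 2 * x^2 + P.coeff 3 * x^3
      + P.coeff 4 * x^4 + x^5 := by
    intro x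
    rw [eval_eq_sum_range, hdeg]
    simp [Finset.sum_range_succ, h5]
  have hDe : ∀ x, (derivative P).eval x = P.coeff 1 + 2 * P.coeff 2 * x + 3 * P.coeff 3 * x^2
      + 4 * P.coeff 4 * x^3 + 5 * x^4 := by
    intro x
    have hlt : (derivative P).natDegree < 5 := by
      have := natDegree_derivative_lt (p := P) (by omega)
      omega
    rw [eval_eq_sum_range' hlt]
    simp [Finset.sum_range_succ, coeff_derivative, h5]
    ring
  have hfin : {x : ℝ | x < 0 ∧ P.eval x = 0}.Finite := by
    apply (P.roots.toFinset.finite_toSet).subset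
    intro x hx
    simp [hP0]
    exact hx.2
  have hemp : ∀ x < 0, P.eval x ≠ 0 := by
    intro x hx h0
    have : {x : ℝ | x < 0 ∧ P.eval x = 0} = ∅ := (Set.ncard_eq_zero hfin).1 hn0
    have h : x ∈ {x : ℝ | x < 0 ∧ P.eval x = 0} := ⟨hx, h0⟩
    rw [this] at h
    exact h
  obtain ⟨x, y, z, hxy, hyz, ⟨hx, hx0⟩, ⟨hy, hy0⟩, ⟨hz, hz0⟩⟩ := sorted3 hp0
  obtain ⟨m, hm1⟩ := hn1
  have hmm : m ∈ {x : ℝ | x < 0 ∧ (derivative P).eval x = 0} := by rw [hm1]; simp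
  obtain ⟨hm0, hmr⟩ := hmm
  have hderiv : ∀ x, HasDerivAt (fun x => P.eval x) ((derivative P).eval x) x :=
    fun x => P.hasDerivAt x
  have hc : Continuous (fun x => P.eval x) := P.continuous
  obtain ⟨u, hu, hu0⟩ := exists_hasDerivAt_eq_zero hxy hc.continuousOn (hx0.trans hy0.symm)
    (fun t _ => hderiv t)
  obtain ⟨v, hv, hv0⟩ := exists_hasDerivAt_eq_zero hyz hc.continuousOn (hy0.trans hz0.symm)
    (fun t _ => hderiv t)
  obtain ⟨t, ht, ht0⟩ := exists_hasDerivAt_eq_slope _ _ hx hc.continuousOn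
    (fun t _ => hderiv t)
  have htpos : 0 < (derivative P).eval t := by
    rw [ht0, hx0]
    have : P.eval 0 < 0 := by rw [hPe]; simpa using he
    apply div_pos <;> linarith
  have hD0 : (derivative P).eval 0 < 0 := by rw [hDe]; simpa using hd
  obtain ⟨w, hw, hw0⟩ := intermediate_value_Ioo ht.1.le (derivative P).continuous.continuousOn
    (show (0:ℝ) ∈ Set.Ioo _ _ from ⟨hD0, htpos⟩)
  simp only at hw0
  obtain ⟨hw1, hw2⟩ := hw
  obtain ⟨ht1, ht2⟩ := ht
  obtain ⟨hu1, hu2⟩ := hu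
  obtain ⟨hv1, hv2⟩ := hv
  have hPm : P.eval m < 0 := by
    by_contra hcon
    have h1 : 0 < P.eval m := lt_of_le_of_ne (not_lt.1 hcon) (hemp m hm0).symm
    have : P.eval 0 < 0 := by rw [hPe]; simpa using he
    obtain ⟨q, hq, hq0⟩ := intermediate_value_Ioo' hm0.le hc.continuousOn
      (show (0:ℝ) ∈ Set.Ioo _ _ from ⟨this, h1⟩)
    exact hemp q hq.2 hq0
  -- factor the derivative
  have hf : ∀ x, (derivative P).eval x - 5*(x-m)*(x-w)*(x-u)*(x-v) =
      (4 * P.coeff 4 + 5*(m+w+u+v)) * x^3 +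
      (3 * P.coeff 3 - 5*(m*w+m*u+m*v+w*u+w*v+u*v)) * x^2 +
      (2 * P.coeff 2 + 5*(m*w*u+m*w*v+m*u*v+w*u*v)) * x +
      (P.coeff 1 - 5*m*w*u*v) := by
    intro x; rw [hDe]; ring
  obtain ⟨c4, c3, c2, c1⟩ := cubic_zero (p := m) (q := w) (r := u) (s := v)
    (by linarith) (by linarith) (by linarith)
    (by rw [← hf, hmr]; ring) (by rw [← hf, hw0]; ring) (by rw [← hf, hu0]; ring)
    (by rw [← hf, hv0]; ring)
  have hDf : ∀ x, (derivative P).eval x = 5*(x-m)*(x-w)*(x-u)*(x-v) := by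
    intro x
    have := hf x
    rw [c4, c3, c2, c1] at this
    linarith
  have hPu : 0 < P.eval u := by
    have hmono : StrictMonoOn (fun x => P.eval x) (Set.Icc x u) := by
      apply strictMonoOn_of_deriv_pos (convex_Icc _ _) hc.continuousOn
      intro s hs
      rw [interior_Icc] at hs
      obtain ⟨hs1, hs2⟩ := hs
      rw [(hderiv s).deriv, hDf]
      have a1 : 0 < s - m := by linarith
      have a2 : 0 < s - w := by linarith
      have a3 : 0 < u - s := by linarith
      have a4 : 0 < v - s := by linarith
      have : 5*(s-m)*(s-w)*(s-u)*(s-v) = 5*(s-m)*(s-w)*(u-s)*(v-s) := by ring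
      rw [this]; positivity
    have := hmono ⟨le_rfl, hu1.le⟩ ⟨hu1.le, le_rfl⟩ hu1
    simp only [hx0] at this
    exact this
  have key : P.eval u - P.eval m = -(5*(u-m)^3/6) *
      (((u+m)/2 - w)*((u+m)/2 - v) + (u-m)^2/20) := by
    rw [hPe, hPe]
    linear_combination (u-m) * c1 + (u^2-m^2)/2 * c2 + (u^3-m^3)/3 * c3 + (u^4-m^4)/4*c4
  have b1 : 0 < w - (u+m)/2 := by linarith
  have b2 : 0 < v - (u+m)/2 := by linarith
  have b3 : 0 < u - m := by linarith
  have : 0 < (5*(u-m)^3/6) * ((w-(u+m)/2)*(v-(u+m)/2) + (u-m)^2/20) := by positivity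
  nlinarith
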